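/- arXiv:2103.10125 — 4 statements merged into one kernel-verified Lean document; each statement's English description precedes it below -/
import Mathlib

section
/- Euler one-step error bound, contractive case (Proposition 1, case λ_u < 0). Let T ⊆ ℝⁿ be a convex compact set, let f : ℝⁿ → ℝⁿ be Lipschitz with constant L on T and satisfy the one-sided Lipschitz condition with constant λ < 0 on T. Let τ > 0, let z₀ ∈ T, let C ≥ L·‖f(z₀)‖, and let ε ≥ 0. Let y : [0,τ] → ℝⁿ be a solution of y'(t) = f(y(t)) with ‖y(0) − z₀‖ ≤ ε, and let Ỹ(t) := z₀ + t·f(z₀) be the explicit Euler approximation; assume y(t) ∈ T and Ỹ(t) ∈ T for all t ∈ [0,τ]. Then for all t ∈ [0,τ]: ‖y(t) − Ỹ(t)‖ ≤ ( ε²·e^{λt} + (C²/λ²)·( t² + 2t/λ + (2/λ²)·(1 − e^{λt}) ) )^{1/2}. -/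
open scoped RealInnerProductSpace NNReal

/-- Grönwall's inequality in differential form: a function with `u' ≤ k u` that starts
nonpositive stays nonpositive. -/
theorem nonpos_of_hasDerivAt_le_mul {u u' : ℝ → ℝ} {k τ : ℝ}
    (hu : ∀ t ∈ Set.Icc (0 : ℝ) τ, HasDerivAt u (u' t) t)
    (hle : ∀ t ∈ Set.Icc (0 : ℝ) τ, u' t ≤ k * u t) (h0 : u 0 ≤ 0) :
    ∀ t ∈ Set.Icc (0 : ℝ) τ, u t ≤ 0 := by
  have hd : ∀ t ∈ Set.Icc (0 : ℝ) τ, HasDerivAt (fun s => u s * Real.exp (-k * s))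
      (u' t * Real.exp (-k * t) + u t * (Real.exp (-k * t) * (-k * 1))) t := fun t ht =>
    (hu t ht).mul ((hasDerivAt_id' t).const_mul (-k)).exp
  have hanti : AntitoneOn (fun s => u s * Real.exp (-k * s)) (Set.Icc 0 τ) := by
    refine antitoneOn_of_deriv_nonpos (convex_Icc 0 τ)
      (fun t ht => (hd t ht).continuousAt.continuousWithinAt)
      (fun t ht => (hd t (interior_subset ht)).differentiableAt.differentiableWithinAt) ?_
    intro t ht
    have ht' := interior_subset ht
    rw [(hd t ht').deriv]
    nlinarith [hle t ht', Real.exp_pos (-k * t)]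
  intro t ht
  have h := hanti ⟨le_rfl, ht.1.trans ht.2⟩ ht ht.1
  simp only [mul_zero, Real.exp_zero, mul_one] at h
  exact nonpos_of_mul_nonpos_left (h.trans h0) (Real.exp_pos _)

/-- The square of the Euler error bound solves `h' = k h - C² t² / k`. -/
theorem hasDerivAt_euler_bound_sq (a C : ℝ) {k : ℝ} (hk : k ≠ 0) (t : ℝ) :
    HasDerivAt (fun t => a * Real.exp (k * t) + C ^ 2 / k ^ 2 *
        (t ^ 2 + 2 * t / k + 2 / k ^ 2 * (1 - Real.exp (k * t))))
      (k * (a * Real.exp (k * t) + C ^ 2 / k ^ 2 *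
        (t ^ 2 + 2 * t / k + 2 / k ^ 2 * (1 - Real.exp (k * t)))) - C ^ 2 * t ^ 2 / k) t := by
  have he : HasDerivAt (fun t => Real.exp (k * t)) (Real.exp (k * t) * (k * 1)) t :=
    ((hasDerivAt_id' t).const_mul k).exp
  have h := (he.const_mul a).add (((((hasDerivAt_id' t).pow 2).add
    (((hasDerivAt_id' t).const_mul 2).div_const k)).add
    ((he.const_sub 1).const_mul (2 / k ^ 2))).const_mul (C ^ 2 / k ^ 2))
  refine h.congr_deriv ?_
  field_simp
  push_cast
  ring

/-- Young's inequality for the error equation of a contractive vector field. -/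
theorem two_mul_add_le_of_neg {k p q c r : ℝ} (hk : k < 0) (hp : p ≤ k * r ^ 2)
    (hq : q ≤ c * r) : 2 * (p + q) ≤ k * r ^ 2 - c ^ 2 / k := by
  have h : k * r ^ 2 - c ^ 2 / k - (2 * (k * r ^ 2) + 2 * (c * r)) = (k * r + c) ^ 2 / (-k) := by
    have := hk.ne
    field_simp
    ring
  have : 0 ≤ (k * r + c) ^ 2 / (-k) := div_nonneg (sq_nonneg _) (by linarith)
  linarith

/-- Euler one-step error bound, contractive case (Proposition 1, case λ < 0). -/
theorem euler_one_step_error_bound_contractive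
    {n : ℕ} (T : Set (EuclideanSpace ℝ (Fin n)))
    (hTconv : Convex ℝ T) (hTcomp : IsCompact T)
    (f : EuclideanSpace ℝ (Fin n) → EuclideanSpace ℝ (Fin n))
    (L : ℝ≥0) (hLip : LipschitzOnWith L f T)
    (lam : ℝ) (hlam : lam < 0)
    (hOSL : ∀ y₁ ∈ T, ∀ y₂ ∈ T, ⟪f y₁ - f y₂, y₁ - y₂⟫ ≤ lam * ‖y₁ - y₂‖ ^ 2)
    (τ : ℝ) (hτ : 0 < τ)
    (z₀ : EuclideanSpace ℝ (Fin n)) (hz₀ : z₀ ∈ T)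
    (C : ℝ) (hC : (L : ℝ) * ‖f z₀‖ ≤ C)
    (ε : ℝ) (hε : 0 ≤ ε)
    (y : ℝ → EuclideanSpace ℝ (Fin n))
    (hsol : ∀ t ∈ Set.Icc (0 : ℝ) τ, HasDerivAt y (f (y t)) t)
    (hinit : ‖y 0 - z₀‖ ≤ ε)
    (hyT : ∀ t ∈ Set.Icc (0 : ℝ) τ, y t ∈ T)
    (hYT : ∀ t ∈ Set.Icc (0 : ℝ) τ, z₀ + t • f z₀ ∈ T) :
    ∀ t ∈ Set.Icc (0 : ℝ) τ,
      ‖y t - (z₀ + t • f z₀)‖ ≤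
        Real.sqrt (ε ^ 2 * Real.exp (lam * t) +
          C ^ 2 / lam ^ 2 *
            (t ^ 2 + 2 * t / lam + 2 / lam ^ 2 * (1 - Real.exp (lam * t)))) := by
  have hderiv : ∀ t ∈ Set.Icc (0 : ℝ) τ,
      HasDerivAt (fun s => ‖y s - (z₀ + s • f z₀)‖ ^ 2)
        (2 * ⟪y t - (z₀ + t • f z₀), f (y t) - f z₀⟫) t := by
    intro t ht
    have hE : HasDerivAt (fun s : ℝ => z₀ + s • f z₀) (f z₀) t := by
      simpa using ((hasDerivAt_id' t).smul_const (f z₀)).const_add z₀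
    exact ((hsol t ht).sub hE).norm_sq
  have key := nonpos_of_hasDerivAt_le_mul (k := lam)
    (fun t ht => (hderiv t ht).sub (hasDerivAt_euler_bound_sq (ε ^ 2) C hlam.ne t)) ?_ ?_
  · intro t ht
    exact Real.le_sqrt_of_sq_le (sub_nonpos.mp (key t ht))
  · intro t ht
    have hC' : ‖f (z₀ + t • f z₀) - f z₀‖ ≤ C * t := by
      have h := hLip.norm_sub_le (hYT t ht) hz₀
      rw [add_sub_cancel_left, norm_smul, Real.norm_of_nonneg ht.1] at h
      nlinarith [mul_le_mul_of_nonneg_right hC ht.1]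
    have hq : ⟪f (z₀ + t • f z₀) - f z₀, y t - (z₀ + t • f z₀)⟫
        ≤ C * t * ‖y t - (z₀ + t • f z₀)‖ :=
      (real_inner_le_norm _ _).trans (mul_le_mul_of_nonneg_right hC' (norm_nonneg _))
    have h := two_mul_add_le_of_neg hlam (hOSL _ (hyT t ht) _ (hYT t ht)) hq
    rw [← inner_add_left, sub_add_sub_cancel, real_inner_comm, mul_pow] at h
    simp only [Pi.sub_apply]
    linarith
  · have h := pow_le_pow_left₀ (norm_nonneg _) hinit 2
    simpa using h
end

section
/- Euler one-step error bound, neutral case (Proposition 1, case λ_u = 0). Let T ⊆ ℝⁿ be a convex compact set, let f : ℝⁿ → ℝⁿ be Lipschitz with constant L on T and satisfy the one-sided Lipschitz condition with constant λ = 0 on T. Let τ > 0, let z₀ ∈ T, let C ≥ L·‖f(z₀)‖, and let ε ≥ 0. Let y : [0,τ] → ℝⁿ be a solution of y'(t) = f(y(t)) with ‖y(0) − z₀‖ ≤ ε, and let Ỹ(t) := z₀ + t·f(z₀); assume y(t) ∈ T and Ỹ(t) ∈ T for all t ∈ [0,τ]. Then for all t ∈ [0,τ]: ‖y(t) − Ỹ(t)‖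 ≤ ( ε²·e^{t} + C²·( −t² − 2t + 2(e^{t} − 1) ) )^{1/2}. -/
open scoped RealInnerProductSpace NNReal

/-- A function with `u' ≤ u` on `[0, b]` that starts nonpositive stays nonpositive. -/
theorem nonpos_of_hasDerivAt_le_self {u u' : ℝ → ℝ} {b : ℝ}
    (hu : ∀ t ∈ Set.Icc (0 : ℝ) b, HasDerivAt u (u' t) t)
    (hle : ∀ t ∈ Set.Icc (0 : ℝ) b, u' t ≤ u t) (h0 : u 0 ≤ 0) :
    ∀ t ∈ Set.Icc (0 : ℝ) b, u t ≤ 0 := by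
  have hderiv : ∀ t ∈ Set.Icc (0 : ℝ) b,
      HasDerivAt (fun s => u s * Real.exp (-s)) ((u' t - u t) * Real.exp (-t)) t := by
    intro t ht
    have h := (hu t ht).mul (hasDerivAt_neg t).exp
    refine h.congr_deriv ?_
    ring
  have hanti : AntitoneOn (fun s => u s * Real.exp (-s)) (Set.Icc 0 b) :=
    antitoneOn_of_hasDerivWithinAt_nonpos (convex_Icc 0 b)
      (fun t ht => (hderiv t ht).continuousAt.continuousWithinAt)
      (fun t ht => (hderiv t (interior_subset ht)).hasDerivWithinAt)
      (fun t ht => mul_nonpos_of_nonpos_of_nonneg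
        (sub_nonpos.2 (hle t (interior_subset ht))) (Real.exp_pos _).le)
  intro t ht
  have h := hanti (Set.left_mem_Icc.2 (ht.1.trans ht.2)) ht ht.1
  simp only [neg_zero, Real.exp_zero, mul_one] at h
  exact nonpos_of_mul_nonpos_left (h.trans h0) (Real.exp_pos _)

/-- Bound on the derivative of the squared distance between a trajectory through `x` and an Euler
step at `w` started from `z`, when `f` is one-sided Lipschitz with constant `0`. -/
theorem two_mul_inner_sub_le_of_inner_sub_nonpos {E : Type*} [NormedAddCommGroup E]
    [InnerProductSpace ℝ E] {f : E → E} {x w z : E} {D : ℝ}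
    (hOSL : ⟪f x - f w, x - w⟫ ≤ 0) (hD : ‖f w - f z‖ ≤ D) :
    2 * ⟪x - w, f x - f z⟫ ≤ ‖x - w‖ ^ 2 + D ^ 2 := by
  have hsplit : ⟪x - w, f x - f z⟫ = ⟪f x - f w, x - w⟫ + ⟪f w - f z, x - w⟫ := by
    rw [← inner_add_left, sub_add_sub_cancel, real_inner_comm]
  have hcs : ⟪f w - f z, x - w⟫ ≤ D * ‖x - w‖ :=
    (real_inner_le_norm _ _).trans (mul_le_mul_of_nonneg_right hD (norm_nonneg _))
  nlinarith [sq_nonneg (‖x - w‖ - D)]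

/-- The squared Euler error bound solves `B' = B + (C t)²`. -/
theorem hasDerivAt_euler_error_sq_bound (ε C t : ℝ) :
    HasDerivAt
      (fun s => ε ^ 2 * Real.exp s + C ^ 2 * (-s ^ 2 - 2 * s + 2 * (Real.exp s - 1)))
      (ε ^ 2 * Real.exp t + C ^ 2 * (-t ^ 2 - 2 * t + 2 * (Real.exp t - 1)) + (C * t) ^ 2) t := by
  have h := ((Real.hasDerivAt_exp t).const_mul (ε ^ 2)).add
    (((((hasDerivAt_pow 2 t).neg).sub ((hasDerivAt_id t).const_mul 2)).add
      (((Real.hasDerivAt_exp t).sub_const 1).const_mul 2)).const_mul (C ^ 2))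
  refine h.congr_deriv ?_
  simp only [Nat.cast_ofNat, Nat.add_one_sub_one, pow_one, mul_one]
  ring

/-- Euler one-step error bound, neutral case (Proposition 1, case λ = 0). -/
theorem euler_one_step_error_bound_neutral
    {n : ℕ} (T : Set (EuclideanSpace ℝ (Fin n)))
    (hTconv : Convex ℝ T) (hTcomp : IsCompact T)
    (f : EuclideanSpace ℝ (Fin n) → EuclideanSpace ℝ (Fin n))
    (L : ℝ≥0) (hLip : LipschitzOnWith L f T)
    (lam : ℝ) (hlam : lam = 0)
    (hOSL : ∀ y₁ ∈ T, ∀ y₂ ∈ T, ⟪f y₁ - f y₂, y₁ - y₂⟫ ≤ lam * ‖y₁ - y₂‖ ^ 2)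
    (τ : ℝ) (hτ : 0 < τ)
    (z₀ : EuclideanSpace ℝ (Fin n)) (hz₀ : z₀ ∈ T)
    (C : ℝ) (hC : (L : ℝ) * ‖f z₀‖ ≤ C)
    (ε : ℝ) (hε : 0 ≤ ε)
    (y : ℝ → EuclideanSpace ℝ (Fin n))
    (hsol : ∀ t ∈ Set.Icc (0 : ℝ) τ, HasDerivAt y (f (y t)) t)
    (hinit : ‖y 0 - z₀‖ ≤ ε)
    (hyT : ∀ t ∈ Set.Icc (0 : ℝ) τ, y t ∈ T)
    (hYT : ∀ t ∈ Set.Icc (0 : ℝ) τ, z₀ + t • f z₀ ∈ T) :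
    ∀ t ∈ Set.Icc (0 : ℝ) τ,
      ‖y t - (z₀ + t • f z₀)‖ ≤
        Real.sqrt (ε ^ 2 * Real.exp t +
          C ^ 2 * (-t ^ 2 - 2 * t + 2 * (Real.exp t - 1))) := by
  subst hlam
  intro t ht
  apply Real.le_sqrt_of_sq_le
  have herr : ∀ s ∈ Set.Icc (0 : ℝ) τ,
      HasDerivAt (fun r => y r - (z₀ + r • f z₀)) (f (y s) - f z₀) s := by
    intro s hs
    have hline : HasDerivAt (fun r : ℝ => z₀ + r • f z₀) (f z₀) s := by
      simpa using ((hasDerivAt_id s).smul_const (f z₀)).const_add z₀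
    exact (hsol s hs).sub hline
  refine sub_nonpos.1 (nonpos_of_hasDerivAt_le_self
    (fun s hs => (herr s hs).norm_sq.sub (hasDerivAt_euler_error_sq_bound ε C s)) ?_ ?_ t ht)
  · intro s hs
    have hstep : ‖f (z₀ + s • f z₀) - f z₀‖ ≤ C * s := by
      have h := hLip.norm_sub_le (hYT s hs) hz₀
      rw [add_sub_cancel_left, norm_smul, Real.norm_of_nonneg hs.1] at h
      nlinarith [mul_le_mul_of_nonneg_right hC hs.1]
    have hosl : ⟪f (y s) - f (z₀ + s • f z₀), y s - (z₀ + s • f z₀)⟫ ≤ 0 := by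
      simpa using hOSL _ (hyT s hs) _ (hYT s hs)
    have h := two_mul_inner_sub_le_of_inner_sub_nonpos hosl hstep
    simp only [Pi.sub_apply]
    linarith
  · simpa using pow_le_pow_left₀ (norm_nonneg _) hinit 2
end

section
/- Euler one-step error bound, expansive case (Proposition 1, case λ_u > 0). Let T ⊆ ℝⁿ be a convex compact set, let f : ℝⁿ → ℝⁿ be Lipschitz with constant L on T and satisfy the one-sided Lipschitz condition with constant λ > 0 on T. Let τ > 0, let z₀ ∈ T, let C ≥ L·‖f(z₀)‖, and let ε ≥ 0. Let y : [0,τ] → ℝⁿ be a solution of y'(t) = f(y(t)) with ‖y(0) − z₀‖ ≤ ε, and let Ỹ(t) := z₀ + t·f(z₀); assume y(t) ∈ T and Ỹ(t) ∈ T for all t ∈ [0,τ]. Then for all t ∈ [0,τ]: ‖y(t) − Ỹ(t)‖ ≤ ( ε²·e^{3λt} + (C²/(3λ²))·( −t² − 2t/(3λ) + (2/(9λ²))·(e^{3λt} − 1) ) )^{1/2}. -/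
open scoped RealInnerProductSpace NNReal

/-- A Grönwall comparison principle: a function with `g' ≤ k g + c` lies below a solution of
`B' = k B + c` that starts above it. -/
theorem le_of_hasDerivAt_le_linear {g g' B c : ℝ → ℝ} {k τ : ℝ}
    (hg : ∀ t ∈ Set.Icc (0 : ℝ) τ, HasDerivAt g (g' t) t)
    (hB : ∀ t ∈ Set.Icc (0 : ℝ) τ, HasDerivAt B (k * B t + c t) t)
    (hle : ∀ t ∈ Set.Icc (0 : ℝ) τ, g' t ≤ k * g t + c t)
    (h0 : g 0 ≤ B 0) {t : ℝ} (ht : t ∈ Set.Icc (0 : ℝ) τ) : g t ≤ B t := by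
  have hd : ∀ s ∈ Set.Icc (0 : ℝ) τ,
      HasDerivAt (fun s => (g s - B s) * Real.exp (-(k * s)))
        ((g' s - (k * B s + c s)) * Real.exp (-(k * s)) +
          (g s - B s) * (Real.exp (-(k * s)) * -(k * 1))) s := fun s hs =>
    ((hg s hs).sub (hB s hs)).mul (((hasDerivAt_id s).const_mul k).neg.exp)
  have hanti : AntitoneOn (fun s => (g s - B s) * Real.exp (-(k * s))) (Set.Icc 0 τ) := by
    refine antitoneOn_of_hasDerivWithinAt_nonpos (convex_Icc 0 τ)
      (fun s hs => (hd s hs).continuousAt.continuousWithinAt)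
      (fun s hs => (hd s (interior_subset hs)).hasDerivWithinAt) fun s hs => ?_
    have h := hle s (interior_subset hs)
    have := mul_nonneg (sub_nonneg.2 h) (Real.exp_pos (-(k * s))).le
    linarith
  have h := hanti (Set.left_mem_Icc.2 (ht.1.trans ht.2)) ht ht.1
  simp only [mul_zero, neg_zero, Real.exp_zero, mul_one] at h
  have := nonpos_of_mul_nonpos_left (h.trans (sub_nonpos.2 h0)) (Real.exp_pos _)
  linarith

/-- The squared error bound solves `B' = 3 λ B + C² t² / λ`. -/
theorem hasDerivAt_expansive_error_bound {lam : ℝ} (hlam : lam ≠ 0) (C ε t : ℝ) :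
    HasDerivAt (fun t : ℝ => ε ^ 2 * Real.exp (3 * lam * t) +
        C ^ 2 / (3 * lam ^ 2) * (-t ^ 2 - 2 * t / (3 * lam) +
          2 / (9 * lam ^ 2) * (Real.exp (3 * lam * t) - 1)))
      (3 * lam * (ε ^ 2 * Real.exp (3 * lam * t) +
        C ^ 2 / (3 * lam ^ 2) * (-t ^ 2 - 2 * t / (3 * lam) +
          2 / (9 * lam ^ 2) * (Real.exp (3 * lam * t) - 1))) + C ^ 2 * t ^ 2 / lam) t := by
  have hE : HasDerivAt (fun t : ℝ => Real.exp (3 * lam * t))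
      (Real.exp (3 * lam * t) * (3 * lam * 1)) t := ((hasDerivAt_id t).const_mul (3 * lam)).exp
  have h := (hE.const_mul (ε ^ 2)).add (((((hasDerivAt_id t).pow 2).neg.sub
    (((hasDerivAt_id t).const_mul 2).div_const (3 * lam))).add
      ((hE.sub_const 1).const_mul (2 / (9 * lam ^ 2)))).const_mul (C ^ 2 / (3 * lam ^ 2)))
  refine h.congr_deriv ?_
  simp only [id]
  field_simp
  ring

/-- Euler one-step error bound, expansive case (Proposition 1, case λ > 0). -/
theorem euler_one_step_error_bound_expansive
    {n : ℕ} (T : Set (EuclideanSpace ℝ (Fin n)))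
    (hTconv : Convex ℝ T) (hTcomp : IsCompact T)
    (f : EuclideanSpace ℝ (Fin n) → EuclideanSpace ℝ (Fin n))
    (L : ℝ≥0) (hLip : LipschitzOnWith L f T)
    (lam : ℝ) (hlam : 0 < lam)
    (hOSL : ∀ y₁ ∈ T, ∀ y₂ ∈ T, ⟪f y₁ - f y₂, y₁ - y₂⟫ ≤ lam * ‖y₁ - y₂‖ ^ 2)
    (τ : ℝ) (hτ : 0 < τ)
    (z₀ : EuclideanSpace ℝ (Fin n)) (hz₀ : z₀ ∈ T)
    (C : ℝ) (hC : (L : ℝ) * ‖f z₀‖ ≤ C)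
    (ε : ℝ) (hε : 0 ≤ ε)
    (y : ℝ → EuclideanSpace ℝ (Fin n))
    (hsol : ∀ t ∈ Set.Icc (0 : ℝ) τ, HasDerivAt y (f (y t)) t)
    (hinit : ‖y 0 - z₀‖ ≤ ε)
    (hyT : ∀ t ∈ Set.Icc (0 : ℝ) τ, y t ∈ T)
    (hYT : ∀ t ∈ Set.Icc (0 : ℝ) τ, z₀ + t • f z₀ ∈ T) :
    ∀ t ∈ Set.Icc (0 : ℝ) τ,
      ‖y t - (z₀ + t • f z₀)‖ ≤
        Real.sqrt (ε ^ 2 * Real.exp (3 * lam * t) +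
          C ^ 2 / (3 * lam ^ 2) *
            (-t ^ 2 - 2 * t / (3 * lam) +
              2 / (9 * lam ^ 2) * (Real.exp (3 * lam * t) - 1))) := by
  intro t ht
  have hY : ∀ s, HasDerivAt (fun s : ℝ => z₀ + s • f z₀) (f z₀) s := fun s => by
    simpa using ((hasDerivAt_id s).smul_const (f z₀)).const_add z₀
  refine Real.le_sqrt_of_sq_le (le_of_hasDerivAt_le_linear
    (g := fun s => ‖y s - (z₀ + s • f z₀)‖ ^ 2) (c := fun s => C ^ 2 * s ^ 2 / lam)
    (fun s hs => ((hsol s hs).sub (hY s)).norm_sq)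
    (fun s _ => hasDerivAt_expansive_error_bound hlam.ne' C ε s) (fun s hs => ?_) ?_ ht)
  · set e := y s - (z₀ + s • f z₀) with he
    have hosl : ⟪f (y s) - f (z₀ + s • f z₀), e⟫ ≤ lam * ‖e‖ ^ 2 :=
      hOSL _ (hyT s hs) _ (hYT s hs)
    have hlip : ‖f (z₀ + s • f z₀) - f z₀‖ ≤ C * s := by
      have h := hLip.norm_sub_le (hYT s hs) hz₀
      rw [add_sub_cancel_left, norm_smul, Real.norm_of_nonneg hs.1] at h
      nlinarith [mul_le_mul_of_nonneg_right hC hs.1]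
    have hdrift : ⟪f (z₀ + s • f z₀) - f z₀, e⟫ ≤ C * s * ‖e‖ :=
      (real_inner_le_norm _ _).trans (mul_le_mul_of_nonneg_right hlip (norm_nonneg e))
    have hsplit : ⟪e, f (y s) - f z₀⟫ =
        ⟪f (y s) - f (z₀ + s • f z₀), e⟫ + ⟪f (z₀ + s • f z₀) - f z₀, e⟫ := by
      rw [← inner_add_left, sub_add_sub_cancel, real_inner_comm]
    have hyoung : 2 * (C * s * ‖e‖) ≤ lam * ‖e‖ ^ 2 + C ^ 2 * s ^ 2 / lam := by
      have h : lam * ‖e‖ ^ 2 + C ^ 2 * s ^ 2 / lam - 2 * (C * s * ‖e‖) =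
          (lam * ‖e‖ - C * s) ^ 2 / lam := by
        field_simp
        ring
      linarith [div_nonneg (sq_nonneg (lam * ‖e‖ - C * s)) hlam.le]
    change 2 * ⟪e, f (y s) - f z₀⟫ ≤ 3 * lam * ‖e‖ ^ 2 + C ^ 2 * s ^ 2 / lam
    linarith
  · simpa using pow_le_pow_left₀ (norm_nonneg _) hinit 2
end

section
/- Grönwall-type bound for the perturbed one-sided Lipschitz condition. Let T ⊆ ℝⁿ be convex, W ⊆ ℝ^d with ‖w‖ ≤ ω for all w ∈ W, and let f : ℝⁿ × ℝ^d → ℝⁿ satisfy the perturbed one-sided Lipschitz condition with constants λ ∈ ℝ and γ ≥ 0 on T and W. Let w₁, w₂ : [0, t₁] → W be measurable, and let y₁, y₂ : [0, t₁] → T be solutions of yᵢ'(t) = f(yᵢ(t), wᵢ(t)). Then for all t ∈ [0, t₁]: if λ ≠ 0, ‖y₁(t) − y₂(t)‖ ≤ e^{λt}·‖y₁(0) − y₂(0)‖ + (2γω/λ)·(e^{λt} − 1); and if λ = 0, ‖y₁(t) − y₂(t)‖ ≤ ‖y₁(0) − y₂(0)‖ + 2γω·t. In particular, for the unperturbed system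 (ω = 0): ‖y₁(t) − y₂(t)‖ ≤ e^{λt}·‖y₁(0) − y₂(0)‖. -/
open scoped RealInnerProductSpace

/-- Grönwall's inequality under a one-sided growth condition: no bound on `‖z'‖` is assumed, only
on its component along `z`. The proof regularizes `‖z‖` to `√(‖z‖ ^ 2 + ε ^ 2)`, which is
differentiable also where `z` vanishes. -/
theorem norm_le_gronwallBound_of_inner_deriv_le {E : Type*} [NormedAddCommGroup E]
    [InnerProductSpace ℝ E] {z z' : ℝ → E} {K c a b : ℝ} (hc : 0 ≤ c)
    (hz : ContinuousOn z (Set.Icc a b))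
    (hz' : ∀ x ∈ Set.Ico a b, HasDerivWithinAt z (z' x) (Set.Ici x) x)
    (bound : ∀ x ∈ Set.Ico a b, ⟪z' x, z x⟫ ≤ K * ‖z x‖ ^ 2 + c * ‖z x‖) :
    ∀ x ∈ Set.Icc a b, ‖z x‖ ≤ gronwallBound ‖z a‖ K c (x - a) := by
  intro x hx
  have regularized : ∀ ε > 0,
      ‖z x‖ ≤ gronwallBound (√(‖z a‖ ^ 2 + ε ^ 2)) K (c + |K| * ε) (x - a) := by
    intro ε hε
    have hpos (t : ℝ) : 0 < ‖z t‖ ^ 2 + ε ^ 2 := by positivity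
    refine (Real.le_sqrt_of_sq_le (by nlinarith)).trans
      (le_gronwallBound_of_liminf_deriv_right_le (f := fun t => √(‖z t‖ ^ 2 + ε ^ 2))
        (f' := fun t => 2 * ⟪z t, z' t⟫ / (2 * √(‖z t‖ ^ 2 + ε ^ 2)))
        (by fun_prop) (fun t ht r hr => ?_) le_rfl (fun t ht => ?_) x hx)
    · exact (((hz' t ht).norm_sq.add_const (ε ^ 2)).sqrt
        (hpos t).ne').liminf_right_slope_le hr
    · have hφ : 0 < √(‖z t‖ ^ 2 + ε ^ 2) := Real.sqrt_pos.2 (hpos t)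
      have hsq := Real.sq_sqrt (hpos t).le
      have hzφ : ‖z t‖ ≤ √(‖z t‖ ^ 2 + ε ^ 2) := Real.le_sqrt_of_sq_le (by nlinarith)
      have hεφ : ε ≤ √(‖z t‖ ^ 2 + ε ^ 2) := Real.le_sqrt_of_sq_le (by nlinarith [sq_nonneg ‖z t‖])
      have hb := bound t ht
      rw [real_inner_comm] at hb
      simp only [mul_div_mul_left _ _ (two_ne_zero' ℝ)]
      generalize √(‖z t‖ ^ 2 + ε ^ 2) = φ at *
      rw [div_le_iff₀ hφ]
      have hcz : c * ‖z t‖ ≤ c * φ := by gcongr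
      have hKε : -K * (ε * ε) ≤ |K| * (ε * φ) := by
        gcongr
        exact neg_le_abs K
      have hKsq : K * φ ^ 2 = K * (‖z t‖ ^ 2 + ε ^ 2) := by rw [hsq]
      linarith
  have hcont : Continuous fun ε : ℝ =>
      gronwallBound (√(‖z a‖ ^ 2 + ε ^ 2)) K (c + |K| * ε) (x - a) := by
    unfold gronwallBound
    split_ifs <;> fun_prop
  have hlim := (hcont.tendsto 0).mono_left (nhdsWithin_le_nhds (s := Set.Ioi 0))
  simpa using ge_of_tendsto hlim (eventually_mem_nhdsWithin.mono regularized)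

/-- Grönwall-type bound for the perturbed one-sided Lipschitz condition. -/
theorem gronwall_perturbed_one_sided_lipschitz
    {n d : ℕ} (T : Set (EuclideanSpace ℝ (Fin n))) (hTconv : Convex ℝ T)
    (W : Set (EuclideanSpace ℝ (Fin d)))
    (ω : ℝ) (hω : ∀ w ∈ W, ‖w‖ ≤ ω)
    (f : EuclideanSpace ℝ (Fin n) → EuclideanSpace ℝ (Fin d) → EuclideanSpace ℝ (Fin n))
    (lam : ℝ) (γ : ℝ) (hγ : 0 ≤ γ)
    (hOSL : ∀ y₁ ∈ T, ∀ y₂ ∈ T, ∀ w₁ ∈ W, ∀ w₂ ∈ W,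
      ⟪f y₁ w₁ - f y₂ w₂, y₁ - y₂⟫ ≤
        lam * ‖y₁ - y₂‖ ^ 2 + γ * ‖y₁ - y₂‖ * ‖w₁ - w₂‖)
    (t₁ : ℝ) (ht₁ : 0 ≤ t₁)
    (w₁ w₂ : ℝ → EuclideanSpace ℝ (Fin d))
    (hw₁meas : Measurable w₁) (hw₂meas : Measurable w₂)
    (hw₁W : ∀ t ∈ Set.Icc (0 : ℝ) t₁, w₁ t ∈ W)
    (hw₂W : ∀ t ∈ Set.Icc (0 : ℝ) t₁, w₂ t ∈ W)
    (y₁ y₂ : ℝ → EuclideanSpace ℝ (Fin n))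
    (hy₁T : ∀ t ∈ Set.Icc (0 : ℝ) t₁, y₁ t ∈ T)
    (hy₂T : ∀ t ∈ Set.Icc (0 : ℝ) t₁, y₂ t ∈ T)
    (hy₁ : ∀ t ∈ Set.Icc (0 : ℝ) t₁, HasDerivAt y₁ (f (y₁ t) (w₁ t)) t)
    (hy₂ : ∀ t ∈ Set.Icc (0 : ℝ) t₁, HasDerivAt y₂ (f (y₂ t) (w₂ t)) t) :
    ∀ t ∈ Set.Icc (0 : ℝ) t₁,
      (lam ≠ 0 →
        ‖y₁ t - y₂ t‖ ≤
          Real.exp (lam * t) * ‖y₁ 0 - y₂ 0‖ +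
            2 * γ * ω / lam * (Real.exp (lam * t) - 1)) ∧
      (lam = 0 → ‖y₁ t - y₂ t‖ ≤ ‖y₁ 0 - y₂ 0‖ + 2 * γ * ω * t) ∧
      (ω = 0 → ‖y₁ t - y₂ t‖ ≤ Real.exp (lam * t) * ‖y₁ 0 - y₂ 0‖) := by
  intro t ht
  have zero_mem : (0 : ℝ) ∈ Set.Icc 0 t₁ := ⟨le_rfl, ht₁⟩
  have hω₀ : 0 ≤ ω := (norm_nonneg _).trans (hω _ (hw₁W 0 zero_mem))
  have key : ‖y₁ t - y₂ t‖ ≤ gronwallBound ‖y₁ 0 - y₂ 0‖ lam (2 * γ * ω) t := by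
    have hderiv (s : ℝ) (hs : s ∈ Set.Icc 0 t₁) := (hy₁ s hs).fun_sub (hy₂ s hs)
    have h := norm_le_gronwallBound_of_inner_deriv_le (z := fun s => y₁ s - y₂ s)
      (K := lam) (c := 2 * γ * ω) (by positivity)
      (fun s hs => (hderiv s hs).continuousAt.continuousWithinAt)
      (fun s hs => (hderiv s (Set.Ico_subset_Icc_self hs)).hasDerivWithinAt)
      (fun s hs => ?_) t ht
    · simpa using h
    · have hs := Set.Ico_subset_Icc_self hs
      have hw : ‖w₁ s - w₂ s‖ ≤ 2 * ω := (norm_sub_le _ _).trans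
        (by linarith [hω _ (hw₁W s hs), hω _ (hw₂W s hs)])
      calc ⟪f (y₁ s) (w₁ s) - f (y₂ s) (w₂ s), y₁ s - y₂ s⟫
          ≤ lam * ‖y₁ s - y₂ s‖ ^ 2 + γ * ‖y₁ s - y₂ s‖ * ‖w₁ s - w₂ s‖ :=
            hOSL _ (hy₁T s hs) _ (hy₂T s hs) _ (hw₁W s hs) _ (hw₂W s hs)
        _ ≤ lam * ‖y₁ s - y₂ s‖ ^ 2 + γ * ‖y₁ s - y₂ s‖ * (2 * ω) := by gcongr
        _ = lam * ‖y₁ s - y₂ s‖ ^ 2 + 2 * γ * ω * ‖y₁ s - y₂ s‖ := by ring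
  refine ⟨fun h => ?_, fun h => ?_, fun h => ?_⟩
  · rw [gronwallBound_of_K_ne_0 h] at key
    rwa [mul_comm (Real.exp _) ‖_‖]
  · rwa [h, gronwallBound_K0] at key
  · rwa [h, mul_zero, gronwallBound_ε0, mul_comm ‖_‖] at key
end
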